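/- Let p be a prime and suppose some prime ℓ with ℓ ≡ 2 (mod 5) or ℓ ≡ 3 (mod 5) divides τ(p⁴). Then p divides τ(p) (i.e., p is not an ordinary prime for the tau-function). -/

import Mathlib

/-- The Ramanujan tau function: `τ(n)` is the coefficient of `qⁿ` in
`q ∏_{i≥1} (1 - qⁱ)²⁴`. Since factors with `i > n` do not affect the
coefficient of `qⁿ`, it suffices to truncate the product at `i = n`. -/
noncomputable def ramanujanTau (n : ℕ) : ℤ :=
  (Polynomial.X * ∏ i ∈ Finset.range n, (1 - Polynomial.X ^ (i + 1)) ^ 24 :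
    Polynomial ℤ).coeff n

open UpperHalfPlane ModularForm Filter Topology
open scoped MatrixGroups

/-- The truncated product `X ∏_{i ≤ N} (1 - Xⁱ)²⁴`. -/
noncomputable def discriminantPartialProd (N : ℕ) : Polynomial ℤ :=
  Polynomial.X * ∏ i ∈ Finset.range N, (1 - Polynomial.X ^ (i + 1)) ^ 24

lemma discriminantPartialProd_coeff_succ {m N : ℕ} (h : m ≤ N) :
    (discriminantPartialProd (N + 1)).coeff m = (discriminantPartialProd N).coeff m := by
  obtain ⟨r, hr⟩ : (Polynomial.X ^ (N + 1) : Polynomial ℤ) ∣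
      (1 - Polynomial.X ^ (N + 1)) ^ 24 - 1 ^ 24 :=
    .trans ⟨-1, by ring⟩ (sub_dvd_pow_sub_pow _ _ 24)
  have h24 : (1 - Polynomial.X ^ (N + 1) : Polynomial ℤ) ^ 24 =
      1 + Polynomial.X ^ (N + 1) * r := by
    rw [← hr]; ring
  have key : discriminantPartialProd (N + 1) = discriminantPartialProd N +
      Polynomial.X ^ (N + 1) * (discriminantPartialProd N * r) := by
    rw [discriminantPartialProd, Finset.prod_range_succ, h24, discriminantPartialProd]
    ring
  rw [key, Polynomial.coeff_add, Polynomial.coeff_X_pow_mul', if_neg (by lia), add_zero]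

lemma discriminantPartialProd_coeff {m N : ℕ} (h : m ≤ N) :
    (discriminantPartialProd N).coeff m = ramanujanTau m := by
  induction N, h using Nat.le_induction with
  | base => rfl
  | succ N hN ih => rw [discriminantPartialProd_coeff_succ hN, ih]

lemma TendstoLocallyUniformlyOn.iteratedDeriv {ι : Type*} {φ : Filter ι} [φ.NeBot]
    {F : ι → ℂ → ℂ} {f : ℂ → ℂ} {U : Set ℂ} (hf : TendstoLocallyUniformlyOn F f φ U)
    (hF : ∀ i, Differentiable ℂ (F i)) (hU : IsOpen U) (m : ℕ) :
    TendstoLocallyUniformlyOn (fun i ↦ _root_.iteratedDeriv m (F i))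
      (_root_.iteratedDeriv m f) φ U := by
  induction m with
  | zero => simpa using hf
  | succ m ih =>
    simp only [iteratedDeriv_succ]
    refine ih.deriv (.of_forall fun i ↦ ?_) hU
    exact ((hF i).contDiff.differentiable_iteratedDeriv m (WithTop.coe_lt_top _)).differentiableOn

lemma tendstoLocallyUniformlyOn_discriminantPartialProd :
    TendstoLocallyUniformlyOn
      (fun N q ↦ ((discriminantPartialProd N).map (Int.castRingHom ℂ)).eval q)
      (fun q ↦ q * ∏' i, (1 - q ^ (i + 1)) ^ 24) atTop (Metric.ball (0 : ℂ) 1) := by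
  have hprod : TendstoLocallyUniformlyOn (fun N q ↦ ∏ i ∈ Finset.range N, (1 - q ^ (i + 1)))
      (fun q : ℂ ↦ ∏' i, (1 - q ^ (i + 1))) atTop (Metric.ball (0 : ℂ) 1) :=
    multipliableLocallyUniformlyOn_one_sub_pow.hasProdLocallyUniformlyOn
      |>.tendstoLocallyUniformlyOn_finsetRange
  have hpow (k : ℕ) : TendstoLocallyUniformlyOn
      (fun N q ↦ (∏ i ∈ Finset.range N, (1 - q ^ (i + 1))) ^ k)
      (fun q : ℂ ↦ (∏' i, (1 - q ^ (i + 1))) ^ k) atTop (Metric.ball (0 : ℂ) 1) := by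
    induction k with
    | zero =>
      simp only [pow_zero]
      exact fun u hu x _ ↦ ⟨Set.univ, Filter.univ_mem, .of_forall fun _ _ _ ↦ refl_mem_uniformity hu⟩
    | succ k ih =>
      simp only [pow_succ]
      exact ih.mul₀ hprod (differentiableOn_tprod_one_sub_pow.continuousOn.pow k)
        differentiableOn_tprod_one_sub_pow.continuousOn
  have hid : TendstoLocallyUniformlyOn (fun (_ : ℕ) q ↦ q)
      (fun q : ℂ ↦ q) atTop (Metric.ball (0 : ℂ) 1) :=
    fun u hu x _ ↦ ⟨Set.univ, Filter.univ_mem, .of_forall fun _ _ _ ↦ refl_mem_uniformity hu⟩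
  have := hid.mul₀ (hpow 24) continuousOn_id
    (differentiableOn_tprod_one_sub_pow.continuousOn.pow 24)
  refine (this.congr fun N q hq ↦ ?_).congr_right fun q hq ↦ ?_
  · simp [discriminantPartialProd, Polynomial.eval_prod, Polynomial.map_prod, Finset.prod_pow]
  · simp [(multipliable_one_sub_pow (by simpa using hq)).tprod_pow 24]

lemma Polynomial.iteratedDeriv_eval_zero (P : Polynomial ℂ) (m : ℕ) :
    iteratedDeriv m (fun q ↦ P.eval q) 0 = m.factorial * P.coeff m := by
  have : iteratedDeriv m (fun q ↦ P.eval q) = fun q ↦ (Polynomial.derivative^[m] P).eval q := by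
    induction m with
    | zero => simp
    | succ m ih =>
      ext q
      rw [iteratedDeriv_succ, ih, Polynomial.deriv, Function.iterate_succ_apply']
  simp only [this]
  rw [← Polynomial.coeff_zero_eq_eval_zero, Polynomial.coeff_iterate_derivative]
  simp [Nat.descFactorial_self]

/-- The `q`-expansion coefficients of the discriminant are the values of the tau function. -/
theorem discriminant_qExpansion_coeff (m : ℕ) :
    (qExpansion 1 discriminant).coeff m = (ramanujanTau m : ℂ) := by
  have h0 : (0 : ℂ) ∈ Metric.ball (0 : ℂ) 1 := Metric.mem_ball_self one_pos
  have hlim := (tendstoLocallyUniformlyOn_discriminantPartialProd.iteratedDeriv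
    (fun N ↦ Polynomial.differentiable _) Metric.isOpen_ball m).tendsto_at h0
  have hconst : Tendsto (fun N ↦ iteratedDeriv m (fun q ↦
      ((discriminantPartialProd N).map (Int.castRingHom ℂ)).eval q) 0) atTop
      (𝓝 (m.factorial * (ramanujanTau m : ℂ))) := by
    refine tendsto_const_nhds.congr' ?_
    filter_upwards [eventually_ge_atTop m] with N hN
    rw [Polynomial.iteratedDeriv_eval_zero, Polynomial.coeff_map,
      discriminantPartialProd_coeff hN, eq_intCast]
  have heq : cuspFunction 1 discriminant =ᶠ[𝓝 0] fun q ↦ q * ∏' i, (1 - q ^ (i + 1)) ^ 24 :=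
    discriminant_cuspFunction_eqOn.eventuallyEq_of_mem (Metric.isOpen_ball.mem_nhds h0)
  rw [qExpansion_coeff, heq.iteratedDeriv_eq, tendsto_nhds_unique hlim hconst]
  exact inv_mul_cancel_left₀ (mod_cast m.factorial_ne_zero) _

/-- The matrix `(p, 0; 0, 1)`. -/
noncomputable def heckeDiag (p : ℕ) [NeZero p] : GL (Fin 2) ℝ :=
  .mkOfDetNeZero !![(p : ℝ), 0; 0, 1] (by simp [NeZero.ne p])

/-- The matrix `(1, b; 0, p)`. -/
noncomputable def heckeShift (p : ℕ) [NeZero p] (b : ℤ) : GL (Fin 2) ℝ :=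
  .mkOfDetNeZero !![1, (b : ℝ); 0, (p : ℝ)] (by simp [NeZero.ne p])

lemma coe_heckeDiag (p : ℕ) [NeZero p] :
    (heckeDiag p : Matrix (Fin 2) (Fin 2) ℝ) = !![(p : ℝ), 0; 0, 1] := rfl

lemma coe_heckeShift (p : ℕ) [NeZero p] (b : ℤ) :
    (heckeShift p b : Matrix (Fin 2) (Fin 2) ℝ) = !![1, (b : ℝ); 0, (p : ℝ)] := rfl

/-- The Hecke operator at a prime `p` in weight `k`, on functions on the upper half-plane. -/
noncomputable def heckeOperator (k : ℤ) (p : ℕ) [NeZero p] (f : ℍ → ℂ) : ℍ → ℂ :=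
  f ∣[k] heckeDiag p + ∑ x : ZMod p, f ∣[k] heckeShift p x.val

section invariance

variable {k : ℤ} {f : ℍ → ℂ} {p : ℕ} [NeZero p]

lemma slash_eq_slash_of_eq_mul (hf : ∀ γ : SL(2, ℤ), f ∣[k] γ = f) {A B : GL (Fin 2) ℝ}
    (a b c d : ℤ) (hdet : a * d - b * c = 1)
    (h : (A : Matrix (Fin 2) (Fin 2) ℝ) = !![(a : ℝ), b; c, d] * B) : f ∣[k] A = f ∣[k] B := by
  let γ : SL(2, ℤ) := ⟨!![a, b; c, d], by rw [Matrix.det_fin_two_of, hdet]⟩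
  have hγ : ((Matrix.SpecialLinearGroup.mapGL ℝ γ : GL (Fin 2) ℝ) : Matrix (Fin 2) (Fin 2) ℝ) =
      !![(a : ℝ), b; c, d] := by
    ext i j
    fin_cases i <;> fin_cases j <;> rfl
  have hA : A = Matrix.SpecialLinearGroup.mapGL ℝ γ * B := by
    ext1
    rw [h, Matrix.GeneralLinearGroup.coe_mul, hγ]
  rw [hA, SlashAction.slash_mul]
  exact congrArg (· ∣[k] B) (hf γ)

lemma coe_modularGroup_S :
    ((ModularGroup.S : GL (Fin 2) ℝ) : Matrix (Fin 2) (Fin 2) ℝ) = !![0, -1; 1, 0] := by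
  ext i j
  change ((ModularGroup.S i j : ℤ) : ℝ) = _
  fin_cases i <;> fin_cases j <;> simp [ModularGroup.S]

lemma coe_modularGroup_T :
    ((ModularGroup.T : GL (Fin 2) ℝ) : Matrix (Fin 2) (Fin 2) ℝ) = !![1, 1; 0, 1] := by
  ext i j
  change ((ModularGroup.T i j : ℤ) : ℝ) = _
  fin_cases i <;> fin_cases j <;> simp [ModularGroup.T]

lemma slash_heckeShift_congr (hf : ∀ γ : SL(2, ℤ), f ∣[k] γ = f) {a b : ℤ}
    (h : (a : ZMod p) = b) : f ∣[k] heckeShift p a = f ∣[k] heckeShift p b := by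
  obtain ⟨m, hm⟩ : (p : ℤ) ∣ a - b := by
    rw [← ZMod.intCast_zmod_eq_zero_iff_dvd]; simp [h]
  refine slash_eq_slash_of_eq_mul hf 1 m 0 1 (by simp) ?_
  have hm' : (a : ℝ) = b + m * p := by
    have : (a : ℝ) - b = p * m := by exact_mod_cast hm
    linarith
  simp [coe_heckeShift, hm']

lemma heckeOperator_slash_T (hf : ∀ γ : SL(2, ℤ), f ∣[k] γ = f) :
    heckeOperator k p f ∣[k] ModularGroup.T = heckeOperator k p f := by
  rw [SL_slash, heckeOperator, SlashAction.add_slash, SlashAction.sum_slash]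
  simp only [← SlashAction.slash_mul]
  congr 1
  · refine slash_eq_slash_of_eq_mul hf 1 p 0 1 (by simp) ?_
    rw [Matrix.GeneralLinearGroup.coe_mul, coe_modularGroup_T, coe_heckeDiag]
    simp
  · refine Fintype.sum_equiv (Equiv.addRight 1) _ _ fun x ↦ ?_
    rw [show heckeShift p x.val * (ModularGroup.T : GL (Fin 2) ℝ) = heckeShift p (x.val + 1) by
      ext1
      rw [Matrix.GeneralLinearGroup.coe_mul, coe_modularGroup_T, coe_heckeShift, coe_heckeShift]
      simp [add_comm]]
    exact slash_heckeShift_congr hf (by simp)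

lemma heckeOperator_slash_S [Fact p.Prime] (hf : ∀ γ : SL(2, ℤ), f ∣[k] γ = f) :
    heckeOperator k p f ∣[k] ModularGroup.S = heckeOperator k p f := by
  have hdiag : f ∣[k] (heckeDiag p * (ModularGroup.S : GL (Fin 2) ℝ)) =
      f ∣[k] heckeShift p (0 : ZMod p).val := by
    refine slash_eq_slash_of_eq_mul hf 0 (-1) 1 0 (by simp) ?_
    rw [Matrix.GeneralLinearGroup.coe_mul, coe_modularGroup_S, coe_heckeShift, coe_heckeDiag]
    simp
  have hzero : f ∣[k] (heckeShift p (0 : ZMod p).val * (ModularGroup.S : GL (Fin 2) ℝ)) =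
      f ∣[k] heckeDiag p := by
    refine slash_eq_slash_of_eq_mul hf 0 (-1) 1 0 (by simp) ?_
    rw [Matrix.GeneralLinearGroup.coe_mul, coe_modularGroup_S, coe_heckeShift, coe_heckeDiag]
    simp
  have hshift (x : ZMod p) (hx : x ≠ 0) :
      f ∣[k] (heckeShift p x.val * (ModularGroup.S : GL (Fin 2) ℝ)) =
        f ∣[k] heckeShift p (-x⁻¹).val := by
    obtain ⟨m, hm⟩ : (p : ℤ) ∣ 1 + x.val * (-x⁻¹).val := by
      rw [← ZMod.intCast_zmod_eq_zero_iff_dvd]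
      simp [hx]
    generalize x.val = u at hm ⊢
    generalize (-x⁻¹).val = v at hm ⊢
    have hm' : (1 : ℝ) + u * v = p * m := by exact_mod_cast hm
    refine slash_eq_slash_of_eq_mul hf u (-m) p (-v) (by linarith) ?_
    rw [Matrix.GeneralLinearGroup.coe_mul, coe_modularGroup_S, coe_heckeShift, coe_heckeShift]
    ext i j
    fin_cases i <;> fin_cases j <;> simp <;> linarith
  rw [SL_slash, heckeOperator, SlashAction.add_slash, SlashAction.sum_slash]
  simp only [← SlashAction.slash_mul]
  rw [hdiag, ← Finset.add_sum_erase _ _ (Finset.mem_univ (0 : ZMod p)), hzero,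
    ← Finset.add_sum_erase _ _ (Finset.mem_univ (0 : ZMod p)), add_left_comm]
  congr 2
  refine Finset.sum_bij' (fun x _ ↦ -x⁻¹) (fun x _ ↦ -x⁻¹) ?_ ?_ ?_ ?_
    fun x hx ↦ hshift x (Finset.ne_of_mem_erase hx)
  all_goals simp +contextual [inv_neg]

end invariance

section formulas

variable (k : ℤ) (f : ℍ → ℂ) (p : ℕ) [NeZero p]

lemma heckeDiag_det_pos : 0 < (heckeDiag p).det.val := by
  simp [coe_heckeDiag, NeZero.pos p]

lemma heckeShift_det_pos (b : ℤ) : 0 < (heckeShift p b).det.val := by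
  simp [coe_heckeShift, NeZero.pos p]

lemma coe_heckeDiag_smul (z : ℍ) : ((heckeDiag p • z : ℍ) : ℂ) = p * z := by
  simp [coe_smul_of_det_pos (heckeDiag_det_pos p), num, denom, coe_heckeDiag]

lemma coe_heckeShift_smul (b : ℤ) (z : ℍ) :
    ((heckeShift p b • z : ℍ) : ℂ) = (z + b) / p := by
  simp [coe_smul_of_det_pos (heckeShift_det_pos p b), num, denom, coe_heckeShift]

lemma slash_heckeDiag_apply (z : ℍ) :
    (f ∣[k] heckeDiag p) z = (p : ℂ) ^ (k - 1) * f (heckeDiag p • z) := by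
  rw [slash_apply, σ, if_pos (heckeDiag_det_pos p)]
  simp [denom, coe_heckeDiag, mul_comm]

lemma slash_heckeShift_apply (b : ℤ) (z : ℍ) :
    (f ∣[k] heckeShift p b) z = (p : ℂ)⁻¹ * f (heckeShift p b • z) := by
  have hp : (p : ℂ) ≠ 0 := NeZero.ne _
  rw [slash_apply, σ, if_pos (heckeShift_det_pos p b)]
  simp [denom, coe_heckeShift, zpow_sub_one₀ hp]
  field_simp

variable {f} in
lemma isZeroAtImInfty_heckeOperator (hf : IsZeroAtImInfty f) :
    IsZeroAtImInfty (heckeOperator k p f) := by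
  have hp : (0 : ℝ) < p := mod_cast NeZero.pos p
  have him : Tendsto UpperHalfPlane.im atImInfty atTop := tendsto_comap
  have hD : Tendsto (heckeDiag p • · : ℍ → ℍ) atImInfty atImInfty := by
    refine tendsto_comap_iff.mpr ((him.const_mul_atTop hp).congr fun z ↦ ?_)
    rw [Function.comp_apply, ← coe_im, ← coe_im, coe_heckeDiag_smul]
    simp
  have hS (b : ℤ) : Tendsto (heckeShift p b • · : ℍ → ℍ) atImInfty atImInfty := by
    refine tendsto_comap_iff.mpr ((him.atTop_div_const hp).congr fun z ↦ ?_)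
    rw [Function.comp_apply, ← coe_im, ← coe_im, coe_heckeShift_smul]
    simp [Complex.div_natCast_im]
  have h1 : Tendsto (f ∣[k] heckeDiag p) atImInfty (𝓝 0) := by
    simp only [funext (slash_heckeDiag_apply k f p)]
    simpa using (hf.comp hD).const_mul ((p : ℂ) ^ (k - 1))
  have h2 (b : ℤ) : Tendsto (f ∣[k] heckeShift p b) atImInfty (𝓝 0) := by
    simp only [funext (slash_heckeShift_apply k f p b)]
    simpa using (hf.comp (hS b)).const_mul ((p : ℂ)⁻¹)
  rw [IsZeroAtImInfty, ZeroAtFilter, heckeOperator]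
  refine (show Tendsto (fun z ↦ (f ∣[k] heckeDiag p) z +
    ∑ x : ZMod p, (f ∣[k] heckeShift p x.val) z) atImInfty (𝓝 0) by
      simpa using h1.add (tendsto_finsetSum Finset.univ fun (x : ZMod p) _ ↦ h2 x.val)).congr
    fun z ↦ by simp only [Pi.add_apply, Finset.sum_apply]

end formulas

/-- The Hecke operator at a prime `p` on cusp forms of level one. -/
noncomputable def CuspForm.hecke {k : ℤ} (p : ℕ) [Fact p.Prime] (f : CuspForm 𝒮ℒ k) :
    CuspForm 𝒮ℒ k :=
  have hf (γ : SL(2, ℤ)) : (f : ℍ → ℂ) ∣[k] γ = f :=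
    f.slash_action_eq' _ ⟨γ, rfl⟩
  have hinv := SlashInvariantForm.slash_action_generators_SL2Z
    (heckeOperator_slash_S (p := p) hf) (heckeOperator_slash_T (p := p) hf)
  { toFun := heckeOperator k p f
    slash_action_eq' := by
      rintro _ ⟨γ, rfl⟩
      exact hinv γ
    holo' := (f.holo'.slash k _).add (MDifferentiable.sum fun _ _ ↦ f.holo'.slash k _)
    zero_at_cusps' := by
      intro c hc
      rw [Subgroup.IsArithmetic.isCusp_iff_isCusp_SL2Z] at hc
      rw [OnePoint.isZeroAt_iff_forall_SL2Z hc]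
      intro γ _
      rw [hinv]
      exact isZeroAtImInfty_heckeOperator k p (CuspFormClass.zero_at_infty f) }

section qExpansion

local notation "𝕢" => Function.Periodic.qParam

lemma ZMod.sum_val_eq_sum_range {M : Type*} [AddCommMonoid M] (p : ℕ) [NeZero p] (g : ℕ → M) :
    ∑ x : ZMod p, g x.val = ∑ i ∈ Finset.range p, g i := by
  cases p with
  | zero => exact absurd rfl (NeZero.ne 0)
  | succ n => exact Fin.sum_univ_eq_sum_range g (n + 1)

lemma hasSum_heckeOperator {k : ℤ} {f : ℍ → ℂ} {a : ℕ → ℂ} (p : ℕ) [hp : Fact p.Prime]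
    (hf : ∀ τ : ℍ, HasSum (fun m ↦ a m • 𝕢 1 τ ^ m) (f τ)) (τ : ℍ) :
    HasSum (fun m ↦ (a (p * m) + if p ∣ m then (p : ℂ) ^ (k - 1) * a (m / p) else 0) •
      𝕢 1 τ ^ m) (heckeOperator k p f τ) := by
  have hp0 : (p : ℂ) ≠ 0 := NeZero.ne _
  have hinj : Function.Injective (p * · : ℕ → ℕ) := fun _ _ h ↦
    Nat.eq_of_mul_eq_mul_left hp.out.pos h
  have hdiag : HasSum (fun m ↦ (if p ∣ m then (p : ℂ) ^ (k - 1) * a (m / p) else 0) •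
      𝕢 1 τ ^ m) ((f ∣[k] heckeDiag p) τ) := by
    rw [slash_heckeDiag_apply, ← hinj.hasSum_iff]
    · refine ((hf (heckeDiag p • τ)).mul_left _).congr_fun fun m ↦ ?_
      have : 𝕢 1 (heckeDiag p • τ : ℍ) = 𝕢 1 τ ^ p := by
        simp only [coe_heckeDiag_smul, Function.Periodic.qParam, ← Complex.exp_nat_mul]
        ring_nf
      simp [this, hp.out.pos, pow_mul, mul_assoc]
    · intro m hm
      rw [if_neg fun ⟨c, hc⟩ ↦ hm ⟨c, hc.symm⟩, zero_smul]
  have hshift : HasSum (fun m ↦ a (p * m) • 𝕢 1 τ ^ m)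
      (∑ x : ZMod p, (f ∣[k] heckeShift p x.val) τ) := by
    set ζ : ℂ := Complex.exp (2 * Real.pi * Complex.I / p)
    have hζ : IsPrimitiveRoot ζ p := Complex.isPrimitiveRoot_exp p hp.out.ne_zero
    set w : ℂ := 𝕢 1 ((τ : ℂ) / p)
    have hw : w ^ p = 𝕢 1 τ := by
      simp only [w, Function.Periodic.qParam, ← Complex.exp_nat_mul]
      congr 1
      field_simp
    have hq (b : ℕ) : 𝕢 1 (heckeShift p b • τ : ℍ) = w * ζ ^ b := by
      simp only [w, ζ, coe_heckeShift_smul, Function.Periodic.qParam, ← Complex.exp_nat_mul,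
        ← Complex.exp_add]
      congr 1
      push_cast
      field_simp
    have hsum : HasSum (fun m ↦ ∑ x : ZMod p, (p : ℂ)⁻¹ * (a m • (w * ζ ^ x.val) ^ m))
        (∑ x : ZMod p, (f ∣[k] heckeShift p x.val) τ) := by
      refine hasSum_sum fun x _ ↦ ?_
      rw [slash_heckeShift_apply, ← hq]
      exact (hf _).mul_left _
    have hcoeff (m : ℕ) : ∑ x : ZMod p, (p : ℂ)⁻¹ * (a m • (w * ζ ^ x.val) ^ m) =
        if p ∣ m then a m * w ^ m else 0 := by
      have h1 : ∑ x : ZMod p, (p : ℂ)⁻¹ * (a m • (w * ζ ^ x.val) ^ m) =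
          (p : ℂ)⁻¹ * (a m * w ^ m) * ∑ i ∈ Finset.range p, (ζ ^ m) ^ i := by
        rw [ZMod.sum_val_eq_sum_range p fun i ↦ (p : ℂ)⁻¹ * (a m • (w * ζ ^ i) ^ m),
          Finset.mul_sum]
        refine Finset.sum_congr rfl fun i _ ↦ ?_
        rw [smul_eq_mul, mul_pow, ← pow_mul, ← pow_mul, mul_comm i m]
        ring
      rw [h1]
      split_ifs with h
      · rw [(hζ.pow_eq_one_iff_dvd m).mpr h]
        simp
        field_simp
      · rw [(hζ.pow_of_coprime m ((hp.out.coprime_iff_not_dvd.mpr h).symm)).geom_sum_eq_zero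
          hp.out.one_lt, mul_zero]
    simp only [hcoeff] at hsum
    rw [← hinj.hasSum_iff] at hsum
    · refine hsum.congr_fun fun m ↦ ?_
      simp [pow_mul, hw]
    · intro m hm
      rw [if_neg fun ⟨c, hc⟩ ↦ hm ⟨c, hc.symm⟩]
  simpa [heckeOperator, add_smul, add_mul, add_comm] using hdiag.add hshift

end qExpansion

lemma ramanujanTau_one : ramanujanTau 1 = 1 := by
  simp [ramanujanTau, Polynomial.coeff_X_mul (n := 0), Polynomial.coeff_zero_eq_eval_zero]

lemma hasSum_ramanujanTau (τ : ℍ) :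
    HasSum (fun m ↦ (ramanujanTau m : ℂ) • Function.Periodic.qParam 1 τ ^ m) (discriminant τ) := by
  simpa [← CuspForm.coe_discriminant, ← discriminant_qExpansion_coeff] using
    ModularForm.hasSum_qExpansion (f := CuspForm.discriminant) one_pos
      one_mem_strictPeriods_SL τ

/-- Hecke's relation for the tau function. -/
theorem ramanujanTau_prime_mul (p : ℕ) [hp : Fact p.Prime] (m : ℕ) :
    ramanujanTau (p * m) + (if p ∣ m then (p : ℤ) ^ 11 * ramanujanTau (m / p) else 0) =
      ramanujanTau p * ramanujanTau m := by
  obtain ⟨c, hc⟩ := CuspForm.exists_smul_discriminant_of_weight_eq_twelve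
    (CuspForm.discriminant.hecke p)
  have hT (z : ℍ) : heckeOperator 12 p discriminant z = c * discriminant z := by
    simpa using! (DFunLike.congr_fun hc z).symm
  have key (m : ℕ) : (ramanujanTau (p * m) : ℂ) +
      (if p ∣ m then (p : ℂ) ^ 11 * ramanujanTau (m / p) else 0) = c * ramanujanTau m := by
    have h1 := ModularFormClass.qExpansion_coeff_unique (f := CuspForm.discriminant.hecke p)
      one_pos one_mem_strictPeriods_SL (hasSum_heckeOperator (k := 12) p hasSum_ramanujanTau) m
    have h2 := ModularFormClass.qExpansion_coeff_unique (f := CuspForm.discriminant.hecke p)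
      one_pos one_mem_strictPeriods_SL (c := fun m ↦ c * ramanujanTau m) (fun z ↦ by
        rw [show CuspForm.discriminant.hecke p z = _ from hT z]
        simpa [mul_assoc] using (hasSum_ramanujanTau z).mul_left c) m
    rw [h2, ← h1]
    norm_num
  have hc' := key 1
  rw [mul_one, if_neg hp.out.not_dvd_one, ramanujanTau_one] at hc'
  have := key m
  rw [show c = ramanujanTau p by simpa using hc'.symm] at this
  exact_mod_cast this

lemma ramanujanTau_prime_pow_add_two (p : ℕ) [hp : Fact p.Prime] (r : ℕ) :
    ramanujanTau (p ^ (r + 2)) =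
      ramanujanTau p * ramanujanTau (p ^ (r + 1)) - (p : ℤ) ^ 11 * ramanujanTau (p ^ r) := by
  have h := ramanujanTau_prime_mul p (p ^ (r + 1))
  rw [if_pos (dvd_pow_self p r.succ_ne_zero), ← pow_succ', pow_succ' p r,
    Nat.mul_div_cancel_left _ hp.out.pos, ← pow_succ'] at h
  exact eq_sub_of_add_eq h

lemma ramanujanTau_prime_pow_four (p : ℕ) [Fact p.Prime] :
    ramanujanTau (p ^ 4) = (ramanujanTau p ^ 2) ^ 2 - 3 * ramanujanTau p ^ 2 * (p : ℤ) ^ 11 +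
      ((p : ℤ) ^ 11) ^ 2 := by
  have h2 := ramanujanTau_prime_pow_add_two p 0
  have h3 := ramanujanTau_prime_pow_add_two p 1
  have h4 := ramanujanTau_prime_pow_add_two p 2
  norm_num [ramanujanTau_one] at h2 h3 h4
  rw [h4, h3, h2]
  ring

lemma not_isSquare_five {ℓ : ℕ} [Fact ℓ.Prime] (h2 : ℓ ≠ 2) (hmod : ℓ % 5 = 2 ∨ ℓ % 5 = 3) :
    ¬IsSquare (5 : ZMod ℓ) := by
  have : Fact (Nat.Prime 5) := ⟨by norm_num⟩
  have h := ZMod.exists_sq_eq_prime_iff_of_mod_four_eq_one (p := 5) (q := ℓ) rfl h2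
  rw [show (5 : ZMod ℓ) = (5 : ℕ) by norm_num, ← h, ← ZMod.natCast_mod]
  clear h
  rcases hmod with h | h <;> rw [h] <;> clear h <;> decide +revert

/-- A prime that is inert in `ℚ(√5)` divides `a² - 3ab + b²` only if it divides `b`. -/
lemma dvd_right_of_dvd_sq_sub_three_mul_add_sq {ℓ : ℕ} (hℓ : ℓ.Prime)
    (hmod : ℓ % 5 = 2 ∨ ℓ % 5 = 3) {a b : ℤ} (h : (ℓ : ℤ) ∣ a ^ 2 - 3 * a * b + b ^ 2) :
    (ℓ : ℤ) ∣ b := by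
  have : Fact ℓ.Prime := ⟨hℓ⟩
  rw [← ZMod.intCast_zmod_eq_zero_iff_dvd] at h ⊢
  push_cast at h
  generalize (a : ZMod ℓ) = a, (b : ZMod ℓ) = b at *
  rcases eq_or_ne ℓ 2 with rfl | h2
  · decide +revert
  · by_contra hb
    refine not_isSquare_five h2 hmod ⟨(2 * a - 3 * b) / b, ?_⟩
    field_simp
    linear_combination -4 * h

theorem not_ordinary_of_prime_dvd_tau_pow_four (p : ℕ) (hp : p.Prime)
    (ℓ : ℕ) (hℓ : ℓ.Prime) (hmod : ℓ % 5 = 2 ∨ ℓ % 5 = 3)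
    (hdvd : (ℓ : ℤ) ∣ ramanujanTau (p ^ 4)) :
    (p : ℤ) ∣ ramanujanTau p := by
  have : Fact p.Prime := ⟨hp⟩
  have hℓ' : Prime (ℓ : ℤ) := Nat.prime_iff_prime_int.mp hℓ
  rw [ramanujanTau_prime_pow_four] at hdvd
  have hb := dvd_right_of_dvd_sq_sub_three_mul_add_sq hℓ hmod hdvd
  have ha := dvd_right_of_dvd_sq_sub_three_mul_add_sq hℓ hmod
    (a := (p : ℤ) ^ 11) (b := ramanujanTau p ^ 2) (by convert hdvd using 1; ring)
  obtain rfl : ℓ = p :=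
    (Nat.prime_dvd_prime_iff_eq hℓ hp).mp (Int.natCast_dvd_natCast.mp (hℓ'.dvd_of_dvd_pow hb))
  exact hℓ'.dvd_of_dvd_pow ha
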